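/- Let (π,U,H) be a covariant representation of (A,δ). Then the map Ψ_{(π,U)} : M(A) → B(H) defined by Ψ_{(π,U)}({a_{mn}}) = Σ_{m,n=0}^∞ U^{*m} π(a_{mn}) U^n is a *-homomorphism with respect to the convolution product ⋆ and the involution of M(A); it satisfies Ψ_{(π,U)}(a) = π(a) for a ∈ A (embedded at entry (0,0)) and Ψ_{(π,U)}(u) = U, it is the unique *-homomorphism with these two properties, and its image equals the *-subalgebra of B(H) generated by π(A) and U. -/

import Mathlib

open Filter Topology
open scoped NNReal

noncomputable section

variable {A : Type*} [CStarAlgebra A]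

/-- The underlying set of the matrix algebra `M(A)`: matrices over `A` with finitely many
nonzero entries satisfying the entry condition `a_{ij} ∈ δ^i(1)·A·δ^j(1)`. -/
def MatMem (δ : A →⋆ₙₐ[ℂ] A) (a : ℕ → ℕ → A) : Prop :=
  ({p : ℕ × ℕ | a p.1 p.2 ≠ 0}).Finite ∧
    ∀ i j : ℕ, (⇑δ)^[i] 1 * a i j * (⇑δ)^[j] 1 = a i j

/-- The shift `Λ : Λ(a)_{ij} = δ(a_{i-1,j-1})` for `i, j ≥ 1`, and `0` otherwise. -/
def lam (δ : A →⋆ₙₐ[ℂ] A) (a : ℕ → ℕ → A) : ℕ → ℕ → A :=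
  fun i j => if i = 0 ∨ j = 0 then 0 else δ (a (i - 1) (j - 1))

/-- Ordinary (finitely supported) matrix multiplication. -/
def matMul (a b : ℕ → ℕ → A) : ℕ → ℕ → A := fun i k => ∑ᶠ j : ℕ, a i j * b j k

/-- The convolution multiplication `a ⋆ b = a·Σ_{j≥0} Λ^j(b) + Σ_{j≥1} Λ^j(a)·b`. -/
def conv (δ : A →⋆ₙₐ[ℂ] A) (a b : ℕ → ℕ → A) : ℕ → ℕ → A :=
  fun i k => (∑ᶠ j : ℕ, matMul a ((lam δ)^[j] b) i k) +
    ∑ᶠ j : ℕ, matMul ((lam δ)^[j + 1] a) b i k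

/-- The involution `(a*)_{mn} = (a_{nm})*`. -/
def mstar (a : ℕ → ℕ → A) : ℕ → ℕ → A := fun i j => star (a j i)

/-- The embedding of `A` into `M(A)` at the `(0,0)` entry. -/
def embed (a : A) : ℕ → ℕ → A := fun i j => if i = 0 ∧ j = 0 then a else 0

/-- The matrix `u`, having `δ(1)` at the `(0,1)` entry and zeros elsewhere. -/
def umat (δ : A →⋆ₙₐ[ℂ] A) : ℕ → ℕ → A := fun i j => if i = 0 ∧ j = 1 then δ 1 else 0

/-- `⋆`-powers of a matrix (`mpow δ x 0` is the matrix unit `embed 1`). -/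
def mpow (δ : A →⋆ₙₐ[ℂ] A) (x : ℕ → ℕ → A) : ℕ → ℕ → ℕ → A
  | 0 => embed 1
  | n + 1 => conv δ (mpow δ x n) x

/-- A matrix is `k`-diagonal if all entries away from the `k`-th diagonal vanish. -/
def IsDiag (k : ℤ) (a : ℕ → ℕ → A) : Prop :=
  ∀ i j : ℕ, a i j ≠ 0 → (j : ℤ) - (i : ℤ) = k

/-- The `n`-th entry `a_n^{(k)}` of the `k`-th diagonal of a matrix. -/
def diagEntry (a : ℕ → ℕ → A) (k : ℤ) (n : ℕ) : A :=
  if 0 ≤ k then a n (n + k.toNat) else a (n + (-k).toNat) n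

/-- `N_k` carries the `k`-th diagonal onto the `0`-th diagonal and deletes the rest. -/
def Nmat (a : ℕ → ℕ → A) (k : ℤ) : ℕ → ℕ → A :=
  fun i j => if i = j then diagEntry a k i else 0

variable {H : Type*} [NormedAddCommGroup H] [InnerProductSpace ℂ H] [CompleteSpace H]

/-- `(π, U, H)` is a covariant representation of `(A, δ)`. -/
def IsCovariantRep (δ : A →⋆ₙₐ[ℂ] A) (π : A →⋆ₐ[ℂ] (H →L[ℂ] H)) (U : H →L[ℂ] H) : Prop :=
  Function.Injective π ∧ U * star U * U = U ∧
    (∀ a : A, U * π a * star U = π (δ a)) ∧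
    (∀ a : A, star U * U * π a = π a * (star U * U))

/-- The map `Ψ_{(π,U)} : M(A) → B(H)`, `a ↦ Σ_{m,n} U^{*m} π(a_{mn}) U^n`. -/
def Psi (π : A →⋆ₐ[ℂ] (H →L[ℂ] H)) (U : H →L[ℂ] H) (a : ℕ → ℕ → A) : H →L[ℂ] H :=
  ∑ᶠ (m : ℕ) (n : ℕ), (star U) ^ m * π (a m n) * U ^ n

/-- Property `(*)` of a covariant representation. -/
def PropertyStar (δ : A →⋆ₙₐ[ℂ] A) (π : A →⋆ₐ[ℂ] (H →L[ℂ] H)) (U : H →L[ℂ] H) : Prop :=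
  ∀ a : ℕ → ℕ → A, MatMem δ a →
    ‖∑ᶠ m : ℕ, (star U) ^ m * π (a m m) * U ^ m‖ ≤ ‖Psi π U a‖

/-- The matrix with entry `x` at position `(m, n)` and zeros elsewhere. -/
def single (m n : ℕ) (x : A) : ℕ → ℕ → A := fun i j => if i = m ∧ j = n then x else 0

/-- `a` vanishes outside the upper left `N × N` block. -/
def SuppIn (N : ℕ) (a : ℕ → ℕ → A) : Prop := ∀ i j, N ≤ i ∨ N ≤ j → a i j = 0

theorem SuppIn.mono {a : ℕ → ℕ → A} {N M : ℕ} (h : SuppIn N a) (hNM : N ≤ M) : SuppIn M a :=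
  fun i j hij => h i j (hij.imp hNM.trans hNM.trans)

theorem MatMem.exists_suppIn {δ : A →⋆ₙₐ[ℂ] A} {a : ℕ → ℕ → A} (ha : MatMem δ a) :
    ∃ N, SuppIn N a := by
  obtain ⟨B, hB⟩ := (ha.1.image fun p => max p.1 p.2).bddAbove
  refine ⟨B + 1, fun i j hij => ?_⟩
  by_contra h
  have : max i j ≤ B := hB ⟨(i, j), h, rfl⟩
  omega

theorem MatMem.exists_suppIn_pair {δ : A →⋆ₙₐ[ℂ] A} {a b : ℕ → ℕ → A}
    (ha : MatMem δ a) (hb : MatMem δ b) : ∃ N, SuppIn N a ∧ SuppIn N b := by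
  obtain ⟨N, hN⟩ := ha.exists_suppIn
  obtain ⟨M, hM⟩ := hb.exists_suppIn
  exact ⟨max N M, hN.mono (le_max_left _ _), hM.mono (le_max_right _ _)⟩

theorem SuppIn.add {a b : ℕ → ℕ → A} {N : ℕ} (ha : SuppIn N a) (hb : SuppIn N b) :
    SuppIn N (a + b) := fun i j h => by
  simp [ha i j h, hb i j h]

theorem MatMem.add {δ : A →⋆ₙₐ[ℂ] A} {a b : ℕ → ℕ → A} (ha : MatMem δ a) (hb : MatMem δ b) :
    MatMem δ (a + b) := by
  refine ⟨(ha.1.union hb.1).subset fun p hp => ?_, fun i j => ?_⟩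
  · by_contra h
    simp only [Set.mem_union, Set.mem_ofPred_eq, not_or, not_not] at h
    exact hp (by simp [h.1, h.2])
  · simp [mul_add, add_mul, ha.2 i j, hb.2 i j]

theorem matMem_single {δ : A →⋆ₙₐ[ℂ] A} {m n : ℕ} {x : A}
    (hx : (⇑δ)^[m] 1 * x * (⇑δ)^[n] 1 = x) : MatMem δ (single m n x) := by
  refine ⟨(Set.finite_singleton (m, n)).subset fun p hp => ?_, fun i j => ?_⟩
  · by_contra h
    exact hp (if_neg fun h' => h (Prod.ext h'.1 h'.2))
  · unfold single
    split_ifs with h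
    · rw [h.1, h.2, hx]
    · simp

theorem single_zero (m n : ℕ) : single m n (0 : A) = 0 := by
  ext i j
  simp [single]

/-- Elements of `M(A)` are generated additively by matrices with a single nonzero entry. -/
@[elab_as_elim]
theorem MatMem.induction {δ : A →⋆ₙₐ[ℂ] A} {P : (ℕ → ℕ → A) → Prop}
    (hsingle : ∀ m n x, (⇑δ)^[m] 1 * x * (⇑δ)^[n] 1 = x → P (single m n x))
    (hadd : ∀ a b, MatMem δ a → MatMem δ b → P a → P b → P (a + b))
    {a : ℕ → ℕ → A} (ha : MatMem δ a) : P a := by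
  classical
  have key : ∀ s : Finset (ℕ × ℕ), MatMem δ (∑ p ∈ s, single p.1 p.2 (a p.1 p.2)) ∧
      P (∑ p ∈ s, single p.1 p.2 (a p.1 p.2)) := by
    intro s
    induction s using Finset.induction_on with
    | empty =>
      rw [Finset.sum_empty, ← single_zero 0 0]
      exact ⟨matMem_single (by simp), hsingle 0 0 0 (by simp)⟩
    | insert p s hp ih =>
      rw [Finset.sum_insert hp]
      have h := ha.2 p.1 p.2
      exact ⟨(matMem_single h).add ih.1,
        hadd _ _ (matMem_single h) ih.1 (hsingle _ _ _ h) ih.2⟩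
  have hsum : ∑ p ∈ ha.1.toFinset, single p.1 p.2 (a p.1 p.2) = a := by
    ext i j
    rw [Finset.sum_apply, Finset.sum_apply, Finset.sum_eq_single (i, j)]
    · simp [single]
    · intro p _ hp
      exact if_neg fun h => hp (Prod.ext h.1.symm h.2.symm)
    · intro h
      simpa [single] using h
  exact hsum ▸ (key ha.1.toFinset).2

section Endomorphism

variable (δ : A →⋆ₙₐ[ℂ] A)

theorem isIdempotentElem_iterate_one (n : ℕ) : (⇑δ)^[n] 1 * (⇑δ)^[n] 1 = (⇑δ)^[n] 1 := by
  rw [← iterate_map_mul, one_mul]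

theorem iterate_add_one_mul (j n : ℕ) :
    (⇑δ)^[n + j] 1 * (⇑δ)^[n] 1 = (⇑δ)^[n + j] 1 := by
  rw [Function.iterate_add_apply, ← iterate_map_mul, mul_one]

theorem iterate_one_mul_add (j n : ℕ) :
    (⇑δ)^[n] 1 * (⇑δ)^[n + j] 1 = (⇑δ)^[n + j] 1 := by
  rw [Function.iterate_add_apply, ← iterate_map_mul, one_mul]

variable {δ}

theorem corner_left {m n : ℕ} {x : A} (hx : (⇑δ)^[m] 1 * x * (⇑δ)^[n] 1 = x) :
    (⇑δ)^[m] 1 * x = x := by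
  rw [← hx, ← mul_assoc, ← mul_assoc, isIdempotentElem_iterate_one]

theorem corner_right {m n : ℕ} {x : A} (hx : (⇑δ)^[m] 1 * x * (⇑δ)^[n] 1 = x) :
    x * (⇑δ)^[n] 1 = x := by
  rw [← hx, mul_assoc, isIdempotentElem_iterate_one]

theorem corner_mul_iterate {m n k l j : ℕ} {x y : A} (hx : (⇑δ)^[m] 1 * x * (⇑δ)^[n] 1 = x)
    (hy : (⇑δ)^[k] 1 * y * (⇑δ)^[l] 1 = y) :
    (⇑δ)^[m] 1 * (x * (⇑δ)^[j] y) * (⇑δ)^[j + l] 1 = x * (⇑δ)^[j] y := by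
  rw [← mul_assoc, corner_left hx, mul_assoc, Function.iterate_add_apply, ← iterate_map_mul,
    corner_right hy]

theorem corner_iterate_mul {m n k l j : ℕ} {x y : A} (hx : (⇑δ)^[m] 1 * x * (⇑δ)^[n] 1 = x)
    (hy : (⇑δ)^[k] 1 * y * (⇑δ)^[l] 1 = y) :
    (⇑δ)^[j + m] 1 * ((⇑δ)^[j] x * y) * (⇑δ)^[l] 1 = (⇑δ)^[j] x * y := by
  rw [mul_assoc, mul_assoc, corner_right hy, ← mul_assoc, Function.iterate_add_apply,
    ← iterate_map_mul, corner_left hx]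

variable (δ)

theorem lam_single (m n : ℕ) (x : A) : lam δ (single m n x) = single (m + 1) (n + 1) (δ x) := by
  ext i j
  rcases i with _ | i <;> rcases j with _ | j <;> simp [lam, single, apply_ite δ]

theorem lam_iterate_single (j m n : ℕ) (x : A) :
    (lam δ)^[j] (single m n x) = single (m + j) (n + j) ((⇑δ)^[j] x) := by
  induction j with
  | zero => rfl
  | succ j ih => rw [Function.iterate_succ_apply', ih, lam_single, Function.iterate_succ_apply',
      add_assoc, add_assoc]

theorem matMul_single (m n k l : ℕ) (x y : A) :
    matMul (single m n x) (single k l y) = if n = k then single m l (x * y) else 0 := by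
  ext i j
  unfold matMul
  rw [finsum_eq_single _ n fun r hr => by simp [single, hr]]
  by_cases h : n = k <;> by_cases hi : i = m <;> by_cases hj : j = l <;> simp [single, h, hi, hj]

theorem conv_single_of_ge (m k l j : ℕ) (x y : A) :
    conv δ (single m (k + j) x) (single k l y) = single m (j + l) (x * (⇑δ)^[j] y) := by
  ext i r
  simp only [conv, lam_iterate_single, matMul_single]
  rw [finsum_eq_single _ j fun t ht => by rw [if_neg (by omega)]; rfl, if_pos rfl,
    finsum_eq_zero_of_forall_eq_zero fun t => by rw [if_neg (by omega)]; rfl, add_zero,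
    add_comm l j]

theorem conv_single_of_lt (m n l j : ℕ) (x y : A) :
    conv δ (single m n x) (single (n + (j + 1)) l y) =
      single (j + 1 + m) l ((⇑δ)^[j + 1] x * y) := by
  ext i r
  simp only [conv, lam_iterate_single, matMul_single]
  rw [finsum_eq_zero_of_forall_eq_zero fun t => by rw [if_neg (by omega)]; rfl, zero_add,
    finsum_eq_single _ j fun t ht => by rw [if_neg (by omega)]; rfl, if_pos rfl,
    add_comm m (j + 1)]

theorem lam_add (a b : ℕ → ℕ → A) : lam δ (a + b) = lam δ a + lam δ b := by
  ext i j
  by_cases h : i = 0 ∨ j = 0 <;> simp [lam, h]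

theorem lam_iterate_add (n : ℕ) (a b : ℕ → ℕ → A) :
    (lam δ)^[n] (a + b) = (lam δ)^[n] a + (lam δ)^[n] b := by
  induction n with
  | zero => rfl
  | succ n ih => simp only [Function.iterate_succ_apply', ih, lam_add]

theorem lam_iterate_apply_eq_zero (n : ℕ) (a : ℕ → ℕ → A) {i j : ℕ} (h : i < n ∨ j < n) :
    (lam δ)^[n] a i j = 0 := by
  induction n generalizing i j with
  | zero => omega
  | succ n ih =>
    rw [Function.iterate_succ_apply', lam]
    split_ifs with h0
    · rfl
    · rw [ih (by omega), map_zero]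

variable {δ}

theorem matMul_eq_sum_of_left {N : ℕ} {a : ℕ → ℕ → A} (ha : SuppIn N a) (b : ℕ → ℕ → A)
    (i k : ℕ) : matMul a b i k = ∑ l ∈ Finset.range N, a i l * b l k := by
  refine finsum_eq_sum_of_support_subset _ fun l hl => ?_
  by_contra h
  exact hl (by simp [ha i l (Or.inr (by simpa using h))])

theorem matMul_eq_sum_of_right {N : ℕ} (a : ℕ → ℕ → A) {b : ℕ → ℕ → A} (hb : SuppIn N b)
    (i k : ℕ) : matMul a b i k = ∑ l ∈ Finset.range N, a i l * b l k := by
  refine finsum_eq_sum_of_support_subset _ fun l hl => ?_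
  by_contra h
  exact hl (by simp [hb l k (Or.inl (by simpa using h))])

theorem conv_eq_sum {N : ℕ} {a b : ℕ → ℕ → A} (ha : SuppIn N a) (hb : SuppIn N b) (i k : ℕ) :
    conv δ a b i k =
      (∑ j ∈ Finset.range (k + 1), ∑ l ∈ Finset.range N, a i l * (lam δ)^[j] b l k) +
      ∑ j ∈ Finset.range i, ∑ l ∈ Finset.range N, (lam δ)^[j + 1] a i l * b l k := by
  simp only [conv, matMul_eq_sum_of_left ha, matMul_eq_sum_of_right _ hb]
  congr 1
  · refine finsum_eq_sum_of_support_subset _ fun j hj => ?_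
    by_contra h
    refine hj (Finset.sum_eq_zero fun l _ => ?_)
    rw [lam_iterate_apply_eq_zero δ j b (Or.inr (by simpa using h)), mul_zero]
  · refine finsum_eq_sum_of_support_subset _ fun j hj => ?_
    by_contra h
    refine hj (Finset.sum_eq_zero fun l _ => ?_)
    rw [lam_iterate_apply_eq_zero δ (j + 1) a (Or.inl ?_), zero_mul]
    simpa [Nat.lt_succ_iff] using h

theorem conv_add_left {a b c : ℕ → ℕ → A} (ha : MatMem δ a) (hb : MatMem δ b)
    (hc : MatMem δ c) : conv δ (a + b) c = conv δ a c + conv δ b c := by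
  obtain ⟨K, hKa, hKb⟩ := ha.exists_suppIn_pair hb
  obtain ⟨M, hM⟩ := hc.exists_suppIn
  have hc' := hM.mono (le_max_right K M)
  have ha' := hKa.mono (le_max_left K M)
  have hb' := hKb.mono (le_max_left K M)
  ext i k
  simp only [Pi.add_apply, conv_eq_sum (ha'.add hb') hc', conv_eq_sum ha' hc',
    conv_eq_sum hb' hc', lam_iterate_add, add_mul, Finset.sum_add_distrib]
  abel

theorem conv_add_right {a b c : ℕ → ℕ → A} (ha : MatMem δ a) (hb : MatMem δ b)
    (hc : MatMem δ c) : conv δ c (a + b) = conv δ c a + conv δ c b := by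
  obtain ⟨K, hKa, hKb⟩ := ha.exists_suppIn_pair hb
  obtain ⟨M, hM⟩ := hc.exists_suppIn
  have hc' := hM.mono (le_max_right K M)
  have ha' := hKa.mono (le_max_left K M)
  have hb' := hKb.mono (le_max_left K M)
  ext i k
  simp only [Pi.add_apply, conv_eq_sum hc' (ha'.add hb'), conv_eq_sum hc' ha',
    conv_eq_sum hc' hb', lam_iterate_add, mul_add, Finset.sum_add_distrib]
  abel

theorem mstar_single (m n : ℕ) (x : A) : mstar (single m n x) = single n m (star x) := by
  ext i j
  simp [mstar, single, apply_ite star, and_comm]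

theorem star_iterate_one (n : ℕ) : star ((⇑δ)^[n] 1) = (⇑δ)^[n] 1 := by
  induction n with
  | zero => simp
  | succ n ih => rw [Function.iterate_succ_apply', ← map_star, ih]

theorem corner_star {m n : ℕ} {x : A} (hx : (⇑δ)^[m] 1 * x * (⇑δ)^[n] 1 = x) :
    (⇑δ)^[n] 1 * star x * (⇑δ)^[m] 1 = star x := by
  conv_rhs => rw [← hx]
  simp only [star_mul, star_iterate_one, mul_assoc]

theorem MatMem.mstar {a : ℕ → ℕ → A} (ha : MatMem δ a) : MatMem δ (mstar a) := by
  refine ha.induction (fun m n x hx => ?_) fun a b _ _ h₁ h₂ => ?_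
  · rw [mstar_single]
    exact matMem_single (corner_star hx)
  · have : _root_.mstar (a + b) = _root_.mstar a + _root_.mstar b := by
      ext i j
      simp [_root_.mstar]
    exact this ▸ h₁.add h₂

/-- Bilinear induction for statements about the convolution product. -/
theorem MatMem.induction_conv {P : (ℕ → ℕ → A) → (ℕ → ℕ → A) → Prop}
    (hge : ∀ m k l j x y, (⇑δ)^[m] 1 * x * (⇑δ)^[k + j] 1 = x →
      (⇑δ)^[k] 1 * y * (⇑δ)^[l] 1 = y → P (single m (k + j) x) (single k l y))
    (hlt : ∀ m n l j x y, (⇑δ)^[m] 1 * x * (⇑δ)^[n] 1 = x →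
      (⇑δ)^[n + (j + 1)] 1 * y * (⇑δ)^[l] 1 = y →
        P (single m n x) (single (n + (j + 1)) l y))
    (hleft : ∀ a b c, MatMem δ a → MatMem δ b → MatMem δ c → P a c → P b c → P (a + b) c)
    (hright : ∀ a b c, MatMem δ a → MatMem δ b → MatMem δ c → P c a → P c b → P c (a + b))
    {a b : ℕ → ℕ → A} (ha : MatMem δ a) (hb : MatMem δ b) : P a b := by
  refine ha.induction (fun m n x hx => ?_) fun a a' ha ha' h h' => hleft a a' b ha ha' hb h h'
  refine hb.induction (fun k l y hy => ?_) fun b b' hb hb' h h' =>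
    hright b b' _ hb hb' (matMem_single hx) h h'
  rcases le_or_gt k n with hkn | hkn
  · obtain ⟨j, rfl⟩ := Nat.exists_eq_add_of_le hkn
    exact hge m k l j x y hx hy
  · obtain ⟨j, rfl⟩ := Nat.exists_eq_add_of_lt hkn
    exact hlt m n l j x y hx hy

theorem MatMem.conv {a b : ℕ → ℕ → A} (ha : MatMem δ a) (hb : MatMem δ b) :
    MatMem δ (conv δ a b) := by
  refine MatMem.induction_conv (P := fun a b => MatMem δ (_root_.conv δ a b))
    (fun m k l j x y hx hy => ?_) (fun m n l j x y hx hy => ?_)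
    (fun a b c ha hb hc h h' => ?_) (fun a b c ha hb hc h h' => ?_) ha hb
  · rw [conv_single_of_ge]
    exact matMem_single (corner_mul_iterate hx hy)
  · rw [conv_single_of_lt]
    exact matMem_single (corner_iterate_mul hx hy)
  · rw [conv_add_left ha hb hc]
    exact h.add h'
  · rw [conv_add_right ha hb hc]
    exact h.add h'

theorem embed_eq_single (x : A) : embed x = single 0 0 x := rfl

theorem umat_eq_single : umat δ = single 0 1 (δ 1) := rfl

theorem matMem_embed (x : A) : MatMem δ (embed x) := by
  rw [embed_eq_single]
  exact matMem_single (by simp)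

theorem matMem_umat : MatMem δ (umat δ) := by
  rw [umat_eq_single]
  exact matMem_single (by simp [← map_mul])

theorem single_succ_right {n : ℕ} {x : A} (hx : x * (⇑δ)^[n + 1] 1 = x) :
    conv δ (single 0 n x) (umat δ) = single 0 (n + 1) x := by
  have h := conv_single_of_ge δ 0 0 1 n x (δ 1)
  rwa [zero_add, ← Function.iterate_succ_apply, hx] at h

theorem single_succ_left {m n : ℕ} {x : A} (hx : (⇑δ)^[m + 1] 1 * x = x) :
    conv δ (mstar (umat δ)) (single m n x) = single (m + 1) n x := by
  rw [umat_eq_single, mstar_single, ← map_star, star_one]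
  rcases m with _ | m
  · have h := conv_single_of_ge δ 1 0 n 0 (δ 1) x
    simp only [Function.iterate_zero, id, add_zero, zero_add] at h
    simp only [zero_add, Function.iterate_one] at hx
    rw [h, hx]
  · have h := conv_single_of_lt δ 1 0 n m (δ 1) x
    rwa [zero_add, ← Function.iterate_succ_apply, hx] at h

theorem corner_of_le {m n m' n' : ℕ} {x : A} (hm : m' ≤ m) (hn : n' ≤ n)
    (hx : (⇑δ)^[m] 1 * x * (⇑δ)^[n] 1 = x) : (⇑δ)^[m'] 1 * x * (⇑δ)^[n'] 1 = x := by
  obtain ⟨i, rfl⟩ := Nat.exists_eq_add_of_le hm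
  obtain ⟨j, rfl⟩ := Nat.exists_eq_add_of_le hn
  have h₁ : (⇑δ)^[m'] 1 * x = x := by
    rw [← corner_left hx, ← mul_assoc, iterate_one_mul_add]
  have h₂ : x * (⇑δ)^[n'] 1 = x := by
    rw [← corner_right hx, mul_assoc, iterate_add_one_mul]
  rw [h₁, h₂]

end Endomorphism

section Representation

variable {δ : A →⋆ₙₐ[ℂ] A} {π : A →⋆ₐ[ℂ] (H →L[ℂ] H)} {U : H →L[ℂ] H}

theorem IsCovariantRep.mul_map (h : IsCovariantRep δ π U) (x : A) :
    U * π x = π (δ x) * U := by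
  obtain ⟨-, hU, hδ, hc⟩ := h
  rw [← hδ, mul_assoc, mul_assoc, ← hc]
  simp only [← mul_assoc]
  rw [hU]

theorem IsCovariantRep.pow_mul_map (h : IsCovariantRep δ π U) (n : ℕ) (x : A) :
    U ^ n * π x = π ((⇑δ)^[n] x) * U ^ n := by
  induction n with
  | zero => simp
  | succ n ih => rw [pow_succ', mul_assoc, ih, ← mul_assoc, h.mul_map, mul_assoc,
      Function.iterate_succ_apply']

theorem IsCovariantRep.map_mul_star_pow (h : IsCovariantRep δ π U) (n : ℕ) (x : A) :
    π x * star U ^ n = star U ^ n * π ((⇑δ)^[n] x) := by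
  have hs : star ((⇑δ)^[n] (star x)) = (⇑δ)^[n] x := by
    induction n with
    | zero => simp
    | succ n ih => rw [Function.iterate_succ_apply', ← map_star, ih, Function.iterate_succ_apply']
  have := congrArg star (h.pow_mul_map n (star x))
  simpa only [star_mul, star_pow, ← map_star, star_star, hs] using this

theorem IsCovariantRep.pow_mul_star_pow (h : IsCovariantRep δ π U) (n : ℕ) :
    U ^ n * star U ^ n = π ((⇑δ)^[n] 1) := by
  induction n with
  | zero => simp
  | succ n ih =>
    rw [pow_succ', pow_succ, mul_assoc, ← mul_assoc (U ^ n), ih, ← mul_assoc, h.2.2.1,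
      Function.iterate_succ_apply']

theorem Psi_eq_sum {N : ℕ} {a : ℕ → ℕ → A} (ha : SuppIn N a) :
    Psi π U a = ∑ m ∈ Finset.range N, ∑ n ∈ Finset.range N,
      star U ^ m * π (a m n) * U ^ n := by
  have hn : ∀ m, ∑ᶠ n, star U ^ m * π (a m n) * U ^ n =
      ∑ n ∈ Finset.range N, star U ^ m * π (a m n) * U ^ n := fun m =>
    finsum_eq_sum_of_support_subset _ fun n hn => by
      by_contra h
      exact hn (by simp [ha m n (Or.inr (by simpa using h))])
  unfold Psi
  simp only [hn]
  refine finsum_eq_sum_of_support_subset _ fun m hm => ?_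
  by_contra h
  exact hm (Finset.sum_eq_zero fun n _ => by simp [ha m n (Or.inl (by simpa using h))])

theorem Psi_add {a b : ℕ → ℕ → A} (ha : MatMem δ a) (hb : MatMem δ b) :
    Psi π U (a + b) = Psi π U a + Psi π U b := by
  obtain ⟨N, hNa, hNb⟩ := ha.exists_suppIn_pair hb
  simp only [Psi_eq_sum hNa, Psi_eq_sum hNb, Psi_eq_sum (hNa.add hNb), Pi.add_apply, map_add,
    mul_add, add_mul, Finset.sum_add_distrib]

theorem Psi_smul (z : ℂ) {a : ℕ → ℕ → A} (ha : MatMem δ a) :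
    Psi π U (z • a) = z • Psi π U a := by
  obtain ⟨N, hN⟩ := ha.exists_suppIn
  have hN' : SuppIn N (z • a) := fun i j h => by simp [hN i j h]
  simp only [Psi_eq_sum hN, Psi_eq_sum hN', Pi.smul_apply, map_smul, mul_smul_comm,
    smul_mul_assoc, Finset.smul_sum]

theorem Psi_single (m n : ℕ) (x : A) : Psi π U (single m n x) = star U ^ m * π x * U ^ n := by
  unfold Psi
  rw [finsum_eq_single _ m, finsum_eq_single _ n]
  · simp [single]
  · intro j hj
    simp [single, hj]
  · intro i hi
    simp [single, hi]

theorem Psi_mstar {a : ℕ → ℕ → A} (ha : MatMem δ a) : Psi π U (mstar a) = star (Psi π U a) := by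
  refine ha.induction (fun m n x hx => ?_) fun a b ha hb h h' => ?_
  · simp only [mstar_single, Psi_single, star_mul, star_pow, star_star, map_star, mul_assoc]
  · have : mstar (a + b) = mstar a + mstar b := by
      ext i j
      simp [mstar]
    rw [this, Psi_add ha.mstar hb.mstar, Psi_add ha hb, star_add, h, h']

theorem Psi_conv (hrep : IsCovariantRep δ π U) {a b : ℕ → ℕ → A} (ha : MatMem δ a)
    (hb : MatMem δ b) : Psi π U (conv δ a b) = Psi π U a * Psi π U b := by
  refine MatMem.induction_conv (P := fun a b => Psi π U (conv δ a b) = Psi π U a * Psi π U b)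
    (fun m k l j x y hx hy => ?_) (fun m n l j x y hx hy => ?_)
    (fun a b c ha hb hc h h' => ?_) (fun a b c ha hb hc h h' => ?_) ha hb
  · rw [conv_single_of_ge, Psi_single, Psi_single, Psi_single]
    calc star U ^ m * π (x * (⇑δ)^[j] y) * U ^ (j + l)
        = star U ^ m * π x * (π ((⇑δ)^[j] y) * U ^ j) * U ^ l := by
          simp only [map_mul, pow_add, mul_assoc]
      _ = star U ^ m * π x * (U ^ j * π ((⇑δ)^[k] 1 * y)) * U ^ l := by
          rw [corner_left hy, hrep.pow_mul_map]
      _ = star U ^ m * π x * U ^ (k + j) * (star U ^ k * π y * U ^ l) := by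
          rw [map_mul, ← hrep.pow_mul_star_pow, add_comm k j, pow_add]
          simp only [mul_assoc]
  · rw [conv_single_of_lt, Psi_single, Psi_single, Psi_single]
    generalize j + 1 = j
    calc star U ^ (j + m) * π ((⇑δ)^[j] x * y) * U ^ l
        = star U ^ m * (star U ^ j * π ((⇑δ)^[j] x)) * π y * U ^ l := by
          rw [add_comm j m]
          simp only [map_mul, pow_add, mul_assoc]
      _ = star U ^ m * (π (x * (⇑δ)^[n] 1) * star U ^ j) * π y * U ^ l := by
          rw [corner_right hx, hrep.map_mul_star_pow]
      _ = star U ^ m * π x * U ^ n * (star U ^ (n + j) * π y * U ^ l) := by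
          rw [map_mul, ← hrep.pow_mul_star_pow, pow_add]
          simp only [mul_assoc]
  · rw [conv_add_left ha hb hc, Psi_add (ha.conv hc) (hb.conv hc), Psi_add ha hb, h, h', add_mul]
  · rw [conv_add_right ha hb hc, Psi_add (hc.conv ha) (hc.conv hb), Psi_add ha hb, h, h', mul_add]

theorem Psi_embed (x : A) : Psi π U (embed x) = π x := by
  simp [embed_eq_single, Psi_single]

theorem Psi_umat (hrep : IsCovariantRep δ π U) : Psi π U (umat δ) = U := by
  rw [umat_eq_single, Psi_single, pow_zero, one_mul, pow_one, ← hrep.mul_map, map_one, mul_one]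

theorem eq_Psi_of_star_hom {Φ : (ℕ → ℕ → A) → (H →L[ℂ] H)}
    (hadd : ∀ a b : ℕ → ℕ → A, MatMem δ a → MatMem δ b → Φ (a + b) = Φ a + Φ b)
    (hmul : ∀ a b : ℕ → ℕ → A, MatMem δ a → MatMem δ b → Φ (conv δ a b) = Φ a * Φ b)
    (hstar : ∀ a : ℕ → ℕ → A, MatMem δ a → Φ (mstar a) = star (Φ a))
    (hembed : ∀ a : A, Φ (embed a) = π a) (humat : Φ (umat δ) = U)
    {a : ℕ → ℕ → A} (ha : MatMem δ a) : Φ a = Psi π U a := by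
  refine ha.induction (fun m n x hx => ?_) fun a b ha hb h h' => ?_
  · rw [Psi_single]
    induction m with
    | zero =>
      induction n with
      | zero => simpa [embed_eq_single] using hembed x
      | succ n ih =>
        have hx' := corner_of_le le_rfl n.le_succ hx
        rw [← single_succ_right (corner_right hx), hmul _ _ (matMem_single hx') matMem_umat,
          ih hx', humat, pow_succ, mul_assoc]
    | succ m ih =>
      have hx' := corner_of_le m.le_succ le_rfl hx
      rw [← single_succ_left (corner_left hx), hmul _ _ matMem_umat.mstar (matMem_single hx'),
        ih hx', hstar _ matMem_umat, humat, pow_succ']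
      simp only [mul_assoc]
  · rw [hadd _ _ ha hb, Psi_add ha hb, h, h']

theorem range_Psi_eq_adjoin (hrep : IsCovariantRep δ π U) :
    {x : H →L[ℂ] H | ∃ a : ℕ → ℕ → A, MatMem δ a ∧ x = Psi π U a} =
      (StarAlgebra.adjoin ℂ (Set.range ⇑π ∪ {U}) : Set (H →L[ℂ] H)) := by
  have hsub := StarAlgebra.subset_adjoin ℂ (Set.range ⇑π ∪ {U})
  apply Set.Subset.antisymm
  · rintro _ ⟨a, ha, rfl⟩
    have hU := hsub (Or.inr rfl)
    refine ha.induction (fun m n x hx => ?_) fun a b ha hb h h' => ?_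
    · rw [Psi_single]
      exact mul_mem (mul_mem (pow_mem (star_mem hU) m) (hsub (Or.inl ⟨x, rfl⟩))) (pow_mem hU n)
    · rw [Psi_add ha hb]
      exact add_mem h h'
  · intro x hx
    induction hx using StarAlgebra.adjoin_induction with
    | mem x hx =>
      rcases hx with ⟨y, rfl⟩ | rfl
      · exact ⟨embed y, matMem_embed y, (Psi_embed y).symm⟩
      · exact ⟨umat δ, matMem_umat, (Psi_umat hrep).symm⟩
    | algebraMap z =>
      exact ⟨embed (algebraMap ℂ A z), matMem_embed _, by rw [Psi_embed, AlgHomClass.commutes]⟩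
    | add x y _ _ hx hy =>
      obtain ⟨a, ha, rfl⟩ := hx
      obtain ⟨b, hb, rfl⟩ := hy
      exact ⟨a + b, ha.add hb, (Psi_add ha hb).symm⟩
    | mul x y _ _ hx hy =>
      obtain ⟨a, ha, rfl⟩ := hx
      obtain ⟨b, hb, rfl⟩ := hy
      exact ⟨conv δ a b, ha.conv hb, (Psi_conv hrep ha hb).symm⟩
    | star x _ hx =>
      obtain ⟨a, ha, rfl⟩ := hx
      exact ⟨mstar a, ha.mstar, (Psi_mstar ha).symm⟩

end Representation

/-- For a covariant representation `(π, U, H)` of `(A, δ)`, the map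
`Ψ_{(π,U)}(a) = Σ_{m,n} U^{*m} π(a_{mn}) U^n` is a `*`-homomorphism on `M(A)` (w.r.t. the
convolution product and the matrix involution), sends the embedded copy of `A` to `π(A)`
and `u` to `U`, is the unique such `*`-homomorphism, and its image is the `*`-subalgebra
of `B(H)` generated by `π(A)` and `U`. -/
theorem Psi_star_hom {A : Type*} [CStarAlgebra A] (δ : A →⋆ₙₐ[ℂ] A)
    {H : Type*} [NormedAddCommGroup H] [InnerProductSpace ℂ H] [CompleteSpace H]
    (π : A →⋆ₐ[ℂ] (H →L[ℂ] H)) (U : H →L[ℂ] H)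
    (hrep : IsCovariantRep δ π U) :
    (∀ a b : ℕ → ℕ → A, MatMem δ a → MatMem δ b →
      Psi π U (a + b) = Psi π U a + Psi π U b) ∧
    (∀ (z : ℂ) (a : ℕ → ℕ → A), MatMem δ a → Psi π U (z • a) = z • Psi π U a) ∧
    (∀ a b : ℕ → ℕ → A, MatMem δ a → MatMem δ b →
      Psi π U (conv δ a b) = Psi π U a * Psi π U b) ∧
    (∀ a : ℕ → ℕ → A, MatMem δ a → Psi π U (mstar a) = star (Psi π U a)) ∧
    (∀ a : A, Psi π U (embed a) = π a) ∧
    Psi π U (umat δ) = U ∧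
    (∀ Φ : (ℕ → ℕ → A) → (H →L[ℂ] H),
      (∀ a b : ℕ → ℕ → A, MatMem δ a → MatMem δ b → Φ (a + b) = Φ a + Φ b) →
      (∀ (z : ℂ) (a : ℕ → ℕ → A), MatMem δ a → Φ (z • a) = z • Φ a) →
      (∀ a b : ℕ → ℕ → A, MatMem δ a → MatMem δ b → Φ (conv δ a b) = Φ a * Φ b) →
      (∀ a : ℕ → ℕ → A, MatMem δ a → Φ (mstar a) = star (Φ a)) →
      (∀ a : A, Φ (embed a) = π a) →
      Φ (umat δ) = U →
      ∀ a : ℕ → ℕ → A, MatMem δ a → Φ a = Psi π U a) ∧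
    {x : H →L[ℂ] H | ∃ a : ℕ → ℕ → A, MatMem δ a ∧ x = Psi π U a} =
      (StarAlgebra.adjoin ℂ (Set.range ⇑π ∪ {U}) : Set (H →L[ℂ] H)) := by
  exact ⟨fun _ _ => Psi_add, fun z _ => Psi_smul z, fun _ _ => Psi_conv hrep, fun _ => Psi_mstar,
    Psi_embed, Psi_umat hrep, fun _ hadd _ hmul hstar hembed humat _ =>
      eq_Psi_of_star_hom hadd hmul hstar hembed humat, range_Psi_eq_adjoin hrep⟩
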